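/- Let q be a prime power, K a finite field with q elements, K̄ an algebraic closure of K, and φ the Frobenius map on P¹(K̄) given by [a : b] ↦ [a^q : b^q]. The number of orbits of the componentwise action of PGL₂(K) on the set of ordered 6-tuples (x₁, …, x₆) of pairwise distinct points of P¹(K̄) satisfying φ(x₁) = x₂, φ(x₂) = x₃, φ(x₃) = x₄, φ(x₄) = x₁, φ(x₅) = x₆ and φ(x₆) = x₅ equals q³ − q². -/

import Mathlib

open Projectivization

/-! ## The projective line and the actions of `GL₂` and `PGL₂` -/

/-- `GL₂(L)` as a group of linear automorphisms of `L²`. -/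
noncomputable def glMulEquiv (L : Type*) [Field L] :
    GL (Fin 2) L ≃* ((Fin 2 → L) ≃ₗ[L] (Fin 2 → L)) :=
  (Matrix.GeneralLinearGroup.toLin).trans
    (LinearMap.GeneralLinearGroup.generalLinearEquiv L (Fin 2 → L))

theorem glMulEquiv_apply (L : Type*) [Field L] (g : GL (Fin 2) L) (v : Fin 2 → L) :
    glMulEquiv L g v = (g : Matrix (Fin 2) (Fin 2) L).mulVec v := by
  simp [glMulEquiv]

/-- The action of `GL₂(L)` on the projective line `P¹(L)`, given in homogeneous
coordinates by `[a : b] ↦ [α a + β b : γ a + δ b]`. -/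
noncomputable def glP1 (L : Type*) [Field L] :
    GL (Fin 2) L →* Function.End (Projectivization L (Fin 2 → L)) where
  toFun g := Projectivization.map (glMulEquiv L g).toLinearMap (glMulEquiv L g).injective
  map_one' := by
    funext x
    induction x using Projectivization.ind with
    | h v hv =>
      show Projectivization.map (glMulEquiv L 1).toLinearMap (glMulEquiv L 1).injective
          (Projectivization.mk L v hv) = Projectivization.mk L v hv
      rw [Projectivization.map_mk, Projectivization.mk_eq_mk_iff']
      exact ⟨1, by simp [glMulEquiv_apply]⟩
  map_mul' g h := by
    funext x
    induction x using Projectivization.ind with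
    | h v hv =>
      show Projectivization.map (glMulEquiv L (g * h)).toLinearMap
          (glMulEquiv L (g * h)).injective (Projectivization.mk L v hv)
        = Projectivization.map (glMulEquiv L g).toLinearMap (glMulEquiv L g).injective
            (Projectivization.map (glMulEquiv L h).toLinearMap (glMulEquiv L h).injective
              (Projectivization.mk L v hv))
      rw [Projectivization.map_mk, Projectivization.map_mk, Projectivization.map_mk,
        Projectivization.mk_eq_mk_iff']
      exact ⟨1, by simp [glMulEquiv_apply, Matrix.mulVec_mulVec]⟩

/-- The action of `GL₂(L)` on `P¹(L)` as a `MulAction`. -/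
noncomputable instance glP1Action (L : Type*) [Field L] :
    MulAction (GL (Fin 2) L) (Projectivization L (Fin 2 → L)) :=
  MulAction.ofEndHom (glP1 L)

/-- The subgroup of scalar matrices inside `GL₂(L)`. -/
def scalarSubgroup (L : Type*) [Field L] : Subgroup (GL (Fin 2) L) :=
  (Units.map ((Matrix.scalar (Fin 2)) : L →+* Matrix (Fin 2) (Fin 2) L).toMonoidHom).range

instance scalarSubgroup_normal (L : Type*) [Field L] : (scalarSubgroup L).Normal := by
  constructor
  rintro n ⟨a, rfl⟩ g
  refine ⟨a, ?_⟩
  have hc : Commute (Units.map ((Matrix.scalar (Fin 2)) :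
      L →+* Matrix (Fin 2) (Fin 2) L).toMonoidHom a) g := by
    apply Units.ext
    simpa using (Matrix.scalar_commute (a : L) (fun r => mul_comm _ _)
      (g : Matrix (Fin 2) (Fin 2) L)).eq
  rw [← hc.eq, mul_assoc, mul_inv_cancel, mul_one]

/-- `PGL₂(K)`: the quotient of `GL₂(K)` by the subgroup of scalar matrices. -/
abbrev PGL2 (K : Type*) [Field K] := GL (Fin 2) K ⧸ scalarSubgroup K

/-- Scalar matrices act trivially on the projective line. -/
theorem glP1_scalar_eq_one (L : Type*) [Field L] (a : Lˣ) :
    glP1 L (Units.map ((Matrix.scalar (Fin 2)) :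
      L →+* Matrix (Fin 2) (Fin 2) L).toMonoidHom a) = 1 := by
  set u := Units.map ((Matrix.scalar (Fin 2)) :
      L →+* Matrix (Fin 2) (Fin 2) L).toMonoidHom a with hu
  funext x
  induction x using Projectivization.ind with
  | h v hv =>
    show Projectivization.map (glMulEquiv L u).toLinearMap (glMulEquiv L u).injective
        (Projectivization.mk L v hv) = Projectivization.mk L v hv
    rw [Projectivization.map_mk, Projectivization.mk_eq_mk_iff']
    refine ⟨(a : L), ?_⟩
    simp [glMulEquiv_apply, hu, Matrix.scalar_apply, Matrix.diagonal_const_mulVec]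

/-- For a field homomorphism `f : K →+* L`, the scalar matrices of `GL₂(K)` act trivially on
`P¹(L)`, hence the action of `GL₂(K)` on `P¹(L)` descends to an action of `PGL₂(K)`. -/
noncomputable def pglP1 {K L : Type*} [Field K] [Field L] (f : K →+* L) :
    PGL2 K →* Function.End (Projectivization L (Fin 2 → L)) :=
  QuotientGroup.lift (scalarSubgroup K)
    ((glP1 L).comp (Matrix.GeneralLinearGroup.map f))
    (by
      rintro z ⟨a, rfl⟩
      have key : Matrix.GeneralLinearGroup.map (n := Fin 2) f
          (Units.map ((Matrix.scalar (Fin 2)) : K →+* Matrix (Fin 2) (Fin 2) K).toMonoidHom a)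
          = Units.map ((Matrix.scalar (Fin 2)) :
              L →+* Matrix (Fin 2) (Fin 2) L).toMonoidHom (Units.map f.toMonoidHom a) := by
        apply Units.ext
        ext i j
        simp [Matrix.GeneralLinearGroup.map, Matrix.scalar_apply, Matrix.diagonal,
          Matrix.map_apply, apply_ite f]
      rw [MonoidHom.mem_ker, MonoidHom.comp_apply, key, glP1_scalar_eq_one])

/-- The action of `PGL₂(K)` on `P¹(L)`, for any extension `L` of `K` via `f : K →+* L`. -/
noncomputable def pglP1Action {K L : Type*} [Field K] [Field L] (f : K →+* L) :
    MulAction (PGL2 K) (Projectivization L (Fin 2 → L)) :=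
  MulAction.ofEndHom (pglP1 f)
/-- The Frobenius map on the projective line `P¹(L)`, acting in homogeneous coordinates by
`[a : b] ↦ [a ^ q : b ^ q]`. -/
noncomputable def frobP1 {L : Type*} [Field L] (q : ℕ)
    (x : Projectivization L (Fin 2 → L)) : Projectivization L (Fin 2 → L) :=
  Projectivization.mk L (fun i => (x.rep i) ^ q) (by
    intro hzero
    obtain ⟨i, hi⟩ := Function.ne_iff.mp x.rep_nonzero
    have h2 : x.rep i ^ q = 0 := congrFun hzero i
    exact hi (by simpa using (pow_eq_zero_iff'.mp h2).1))

noncomputable instance pglP1ClosureAction (K : Type*) [Field K] :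
    MulAction (PGL2 K)
      (Projectivization (AlgebraicClosure K) (Fin 2 → AlgebraicClosure K)) :=
  pglP1Action (algebraMap K (AlgebraicClosure K))

section PGLClosure

variable {K : Type*} [Field K]

theorem pgl_smul_mk (g : GL (Fin 2) K) (v : Fin 2 → AlgebraicClosure K) (hv : v ≠ 0) :
    (QuotientGroup.mk g : PGL2 K) • (Projectivization.mk (AlgebraicClosure K) v hv) =
      Projectivization.mk (AlgebraicClosure K)
        (glMulEquiv _ (Matrix.GeneralLinearGroup.map (algebraMap K (AlgebraicClosure K)) g) v)
        (by simpa using hv) :=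
  rfl

theorem frobP1_mk {L : Type*} [Field L] {q : ℕ} (v : Fin 2 → L) (hv : v ≠ 0)
    (hv' : (fun i => v i ^ q) ≠ 0) :
    frobP1 q (Projectivization.mk L v hv) = Projectivization.mk L (fun i => v i ^ q) hv' := by
  obtain ⟨a, ha⟩ := Projectivization.exists_smul_eq_mk_rep L v hv
  unfold frobP1
  rw [Projectivization.mk_eq_mk_iff']
  refine ⟨(a : L) ^ q, ?_⟩
  funext i
  rw [← ha]
  simp [Units.smul_def, mul_pow]

theorem pow_fun_ne_zero {L : Type*} [Field L] {q : ℕ} {v : Fin 2 → L} (hv : v ≠ 0) :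
    (fun i => v i ^ q) ≠ 0 := by
  obtain ⟨i, hi⟩ := Function.ne_iff.mp hv
  exact fun h => hi (pow_eq_zero_iff'.mp (congrFun h i)).1

/-- The affine chart `z ↦ [z : 1]`. -/
def affinePoint {L : Type*} [Field L] (z : L) : Projectivization L (Fin 2 → L) :=
  Projectivization.mk L ![z, 1] (by simp)

theorem affinePoint_injective {L : Type*} [Field L] :
    Function.Injective (affinePoint (L := L)) := by
  intro z w h
  rw [affinePoint, affinePoint, Projectivization.mk_eq_mk_iff'] at h
  obtain ⟨a, ha⟩ := h
  have h0 := congrFun ha 0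
  have h1 := congrFun ha 1
  simp at h0 h1
  simpa [h1] using h0.symm

theorem frobP1_affinePoint {L : Type*} [Field L] (q : ℕ) (z : L) :
    frobP1 q (affinePoint z) = affinePoint (z ^ q) := by
  rw [affinePoint, frobP1_mk _ _ (pow_fun_ne_zero (by simp)), affinePoint]
  congr 1
  funext i
  fin_cases i <;> simp

theorem iterate_frobP1_affinePoint {L : Type*} [Field L] (q n : ℕ) (z : L) :
    (frobP1 q)^[n] (affinePoint z) = affinePoint (z ^ q ^ n) := by
  induction n with
  | zero => simp
  | succ n ih => rw [Function.iterate_succ_apply', ih, frobP1_affinePoint, ← pow_mul, pow_succ]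

theorem exists_affinePoint_eq {L : Type*} [Field L] {q : ℕ} (hq : q ≠ 0)
    {x : Projectivization L (Fin 2 → L)} (hx : frobP1 q x ≠ x) : ∃ z, affinePoint z = x := by
  induction x using Projectivization.ind with
  | h v hv =>
    by_cases h1 : v 1 = 0
    · refine absurd ?_ hx
      have h0 : v 0 ≠ 0 := fun h0 => hv (by funext i; fin_cases i <;> assumption)
      rw [frobP1_mk _ _ (pow_fun_ne_zero hv), Projectivization.mk_eq_mk_iff']
      refine ⟨v 0 ^ q / v 0, ?_⟩
      funext i
      fin_cases i
      · simp [h0]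
      · simp [h1, hq]
    · refine ⟨v 0 / v 1, ?_⟩
      rw [affinePoint, Projectivization.mk_eq_mk_iff']
      refine ⟨(v 1)⁻¹, ?_⟩
      funext i
      fin_cases i
      · simp [div_eq_inv_mul]
      · simp [h1]

theorem ncard_iterate_frobP1 {L : Type*} [Field L] {q : ℕ} (hq : q ≠ 0) (m n : ℕ)
    (hmn : m ∣ n)
    (hfin : {z : L | z ^ q ^ n = z}.Finite) :
    {x : Projectivization L (Fin 2 → L) |
      (frobP1 q)^[n] x = x ∧ (frobP1 q)^[m] x ≠ x}.ncard =
      {z : L | z ^ q ^ n = z}.ncard - {z : L | z ^ q ^ m = z}.ncard := by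
  have hsub : {z : L | z ^ q ^ m = z} ⊆ {z : L | z ^ q ^ n = z} := by
    intro z hz
    obtain ⟨k, rfl⟩ := hmn
    have hz' : (fun w : L => w ^ q ^ m) z = z := hz
    have h : (fun w : L => w ^ q ^ m)^[k] z = z := Function.iterate_fixed hz' k
    rwa [pow_iterate, ← pow_mul] at h
  rw [← Set.ncard_sdiff hsub (hfin.subset hsub),
    ← Set.ncard_image_of_injective _ (affinePoint_injective (L := L))]
  congr 1
  ext x
  constructor
  · rintro ⟨hn, hm⟩
    have hx : frobP1 q x ≠ x := fun h => hm (Function.iterate_fixed h m)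
    obtain ⟨z, rfl⟩ := exists_affinePoint_eq hq hx
    rw [iterate_frobP1_affinePoint] at hn hm
    exact ⟨z, ⟨affinePoint_injective hn, fun h => hm (congrArg _ h)⟩, rfl⟩
  · rintro ⟨z, ⟨hn, hm⟩, rfl⟩
    simp only [Set.mem_ofPred_eq, iterate_frobP1_affinePoint]
    exact ⟨congrArg _ hn, fun h => hm (affinePoint_injective h)⟩

theorem injective_iff_of_cycles {α : Type*} {φ : α → α} {x : Fin 6 → α}
    (h01 : φ (x 0) = x 1) (h12 : φ (x 1) = x 2) (h23 : φ (x 2) = x 3) (h30 : φ (x 3) = x 0)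
    (h45 : φ (x 4) = x 5) (h54 : φ (x 5) = x 4) :
    Function.Injective x ↔ φ (φ (x 0)) ≠ x 0 ∧ φ (x 4) ≠ x 4 := by
  constructor
  · intro h
    rw [h01, h12, h45]
    exact ⟨h.ne (by decide), h.ne (by decide)⟩
  · rintro ⟨h0, h4⟩ i j hij
    fin_cases i <;> fin_cases j <;> simp at hij ⊢ <;> grind

variable [Fintype K]

theorem finite_ncard_pow_card_pow_eq_self {n : ℕ} (hn : n ≠ 0) :
    {z : AlgebraicClosure K | z ^ Fintype.card K ^ n = z}.Finite ∧
    {z : AlgebraicClosure K | z ^ Fintype.card K ^ n = z}.ncard = Fintype.card K ^ n := by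
  classical
  obtain ⟨p, hp⟩ := CharP.exists K
  have := hp
  obtain ⟨k, hpr, hk⟩ := FiniteField.card K p
  have := Fact.mk hpr
  have h1 : 1 < Fintype.card K ^ n := Nat.one_lt_pow hn Fintype.one_lt_card
  have hsep : (Polynomial.X ^ (Fintype.card K ^ n) - Polynomial.X :
      Polynomial (AlgebraicClosure K)).Separable := by
    have : CharP (AlgebraicClosure K) p := charP_of_injective_algebraMap' K p
    refine galois_poly_separable p _ ?_
    rw [hk, ← pow_mul]
    exact dvd_pow_self p (by simp [hn])
  have hset : {z : AlgebraicClosure K | z ^ Fintype.card K ^ n = z} =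
      (Polynomial.X ^ (Fintype.card K ^ n) - Polynomial.X :
        Polynomial (AlgebraicClosure K)).rootSet (AlgebraicClosure K) := by
    ext z
    rw [Polynomial.mem_rootSet_of_ne (FiniteField.X_pow_card_sub_X_ne_zero _ h1)]
    simp [sub_eq_zero]
  rw [hset]
  refine ⟨Polynomial.rootSet_finite _ _, ?_⟩
  rw [← Nat.card_coe_set_eq, Nat.card_eq_fintype_card,
    Polynomial.card_rootSet_eq_natDegree hsep (IsAlgClosed.splits _),
    FiniteField.X_pow_card_sub_X_natDegree_eq _ h1]

theorem frobP1_smul (g : PGL2 K)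
    (x : Projectivization (AlgebraicClosure K) (Fin 2 → AlgebraicClosure K)) :
    frobP1 (Fintype.card K) (g • x) = g • frobP1 (Fintype.card K) x := by
  induction g using QuotientGroup.induction_on with
  | H g =>
  induction x using Projectivization.ind with
  | h v hv =>
    rw [pgl_smul_mk, frobP1_mk _ _ (pow_fun_ne_zero (by simpa using hv)),
      frobP1_mk _ _ (pow_fun_ne_zero hv), pgl_smul_mk]
    congr 1
    funext i
    have h := map_add (FiniteField.frobeniusAlgHom K (AlgebraicClosure K))
    have h' := (FiniteField.frobeniusAlgHom K (AlgebraicClosure K)).commutes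
    simp only [FiniteField.coe_frobeniusAlgHom] at h h'
    simp [glMulEquiv_apply, Matrix.mulVec, dotProduct, Fin.sum_univ_two, h, h', mul_pow]

/-- A quadratic form relation over `K` satisfied by an element of degree greater than two
is trivial. -/
theorem eq_zero_of_quadratic {z : AlgebraicClosure K} (hz : z ^ Fintype.card K ^ 2 ≠ z)
    {a b c : K}
    (h : algebraMap K (AlgebraicClosure K) a * z ^ 2 + algebraMap K _ b * z
      + algebraMap K _ c = 0) : a = 0 ∧ b = 0 ∧ c = 0 := by
  set σ := FiniteField.frobeniusAlgHom K (AlgebraicClosure K) with hσ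
  have hσz : σ (σ z) ≠ z := by
    simpa [hσ, ← pow_mul, ← pow_two] using hz
  have hroot : ∀ w, algebraMap K (AlgebraicClosure K) a * w ^ 2 + algebraMap K _ b * w
      + algebraMap K _ c = 0 → algebraMap K (AlgebraicClosure K) a * (σ w) ^ 2
      + algebraMap K _ b * σ w + algebraMap K _ c = 0 := by
    intro w hw
    simpa using congrArg σ hw
  have h1 := hroot _ h
  have h2 := hroot _ h1
  have n1 : σ z ≠ z := fun e => hσz (by rw [e, e])
  have n2 : σ (σ z) ≠ σ z := fun e => n1 (σ.toRingHom.injective e)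
  set A := algebraMap K (AlgebraicClosure K) a with hA
  set B := algebraMap K (AlgebraicClosure K) b with hB
  set C := algebraMap K (AlgebraicClosure K) c with hC
  have e1 : A * (σ z + z) + B = 0 :=
    mul_left_cancel₀ (sub_ne_zero.mpr n1) (by linear_combination h1 - h)
  have e2 : A * (σ (σ z) + σ z) + B = 0 :=
    mul_left_cancel₀ (sub_ne_zero.mpr n2) (by linear_combination h2 - h1)
  have eA : A = 0 :=
    mul_left_cancel₀ (sub_ne_zero.mpr hσz) (by linear_combination e2 - e1)
  have eB : B = 0 := by simpa [eA] using e1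
  have eC : C = 0 := by simpa [eA, eB] using h
  simpa [hA, hB, hC] using And.intro eA (And.intro eB eC)

theorem eq_one_of_smul_eq {g : PGL2 K}
    {x : Projectivization (AlgebraicClosure K) (Fin 2 → AlgebraicClosure K)}
    (hx : (frobP1 (Fintype.card K))^[2] x ≠ x) (hg : g • x = x) : g = 1 := by
  have hx1 : frobP1 (Fintype.card K) x ≠ x := fun h => hx (Function.iterate_fixed h 2)
  obtain ⟨z, rfl⟩ := exists_affinePoint_eq Fintype.card_ne_zero hx1
  rw [iterate_frobP1_affinePoint] at hx
  induction g using QuotientGroup.induction_on with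
  | H g =>
  rw [affinePoint, pgl_smul_mk, Projectivization.mk_eq_mk_iff'] at hg
  obtain ⟨t, ht⟩ := hg
  have h0 := congrFun ht 0
  have h1 := congrFun ht 1
  simp [glMulEquiv_apply, Matrix.mulVec, dotProduct, Fin.sum_univ_two] at h0 h1
  obtain ⟨h10, hd, h01⟩ := eq_zero_of_quadratic (fun h => hx (congrArg _ h))
    (a := g 1 0) (b := g 1 1 - g 0 0) (c := - g 0 1) (z := z)
    (by simp only [map_sub, map_neg]; linear_combination h0 - z * h1)
  have hd : g 1 1 = g 0 0 := sub_eq_zero.mp hd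
  have h01 : g 0 1 = 0 := neg_eq_zero.mp h01
  have h00 : g 0 0 ≠ 0 := by
    intro h
    have := g.det.ne_zero
    simp [Matrix.det_fin_two, h, h10] at this
  rw [QuotientGroup.eq_one_iff]
  refine ⟨Units.mk0 _ h00, ?_⟩
  ext i j
  fin_cases i <;> fin_cases j <;> simp [h10, h01, hd]

theorem card_PGL2 :
    Nat.card (PGL2 K) * (Fintype.card K - 1) =
      (Fintype.card K ^ 2 - 1) * (Fintype.card K ^ 2 - Fintype.card K) := by
  have h := Subgroup.card_eq_card_quotient_mul_card_subgroup (scalarSubgroup K)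
  have hs : Nat.card (scalarSubgroup K) = Fintype.card K - 1 := by
    rw [← Nat.card_eq_fintype_card, ← Nat.card_units]
    refine (Nat.card_congr (MonoidHom.ofInjective ?_).toEquiv).symm
    intro a b hab
    have := congrArg (fun u : GL (Fin 2) K => u 0 0) hab
    exact Units.ext (by simpa using this)
  rw [hs, Matrix.card_GL_field] at h
  rw [← h]
  simp [Fin.prod_univ_two]

variable (K) in
/-- The injective 6-tuples consisting of a Frobenius 4-cycle and a Frobenius 2-cycle. -/
def frobTuples : SubMulAction (PGL2 K)
    (Fin 6 → Projectivization (AlgebraicClosure K) (Fin 2 → AlgebraicClosure K)) where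
  carrier := {x | Function.Injective x ∧
    frobP1 (Fintype.card K) (x 0) = x 1 ∧
    frobP1 (Fintype.card K) (x 1) = x 2 ∧
    frobP1 (Fintype.card K) (x 2) = x 3 ∧
    frobP1 (Fintype.card K) (x 3) = x 0 ∧
    frobP1 (Fintype.card K) (x 4) = x 5 ∧
    frobP1 (Fintype.card K) (x 5) = x 4}
  smul_mem' := by
    rintro g x ⟨hi, h⟩
    refine ⟨(MulAction.injective g).comp hi, ?_⟩
    simpa only [Pi.smul_apply, frobP1_smul, smul_left_cancel_iff] using h

theorem card_frobTuples :
    Nat.card (frobTuples K) = (Fintype.card K ^ 4 - Fintype.card K ^ 2) *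
      (Fintype.card K ^ 2 - Fintype.card K) := by
  set φ : Projectivization (AlgebraicClosure K) (Fin 2 → AlgebraicClosure K) → _ :=
    frobP1 (Fintype.card K) with hφ
  have h4 := ncard_iterate_frobP1 Fintype.card_ne_zero 2 4 (by decide)
    (finite_ncard_pow_card_pow_eq_self (K := K) (n := 4) (by decide)).1
  have h2 := ncard_iterate_frobP1 Fintype.card_ne_zero 1 2 (by decide)
    (finite_ncard_pow_card_pow_eq_self (K := K) (n := 2) (by decide)).1
  rw [(finite_ncard_pow_card_pow_eq_self (by decide)).2,
    (finite_ncard_pow_card_pow_eq_self (by decide)).2] at h4 h2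
  rw [pow_one] at h2
  rw [← h4, ← h2, ← Nat.card_coe_set_eq, ← Nat.card_coe_set_eq, ← Nat.card_prod]
  refine Nat.card_congr
    { toFun := fun x => ⟨⟨x.1 0, ?_⟩, ⟨x.1 4, ?_⟩⟩
      invFun := fun y => ⟨![y.1.1, φ y.1.1, φ (φ y.1.1), φ (φ (φ y.1.1)), y.2.1, φ y.2.1], ?_⟩
      left_inv := ?_
      right_inv := fun y => rfl }
  · obtain ⟨x, hi, h01, h12, h23, h30, h45, h54⟩ := x
    have := (injective_iff_of_cycles h01 h12 h23 h30 h45 h54).1 hi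
    exact ⟨by simp [h01, h12, h23, h30], this.1⟩
  · obtain ⟨x, hi, h01, h12, h23, h30, h45, h54⟩ := x
    have := (injective_iff_of_cycles h01 h12 h23 h30 h45 h54).1 hi
    exact ⟨by simp [h45, h54], this.2⟩
  · obtain ⟨⟨a, ha, ha'⟩, ⟨b, hb, hb'⟩⟩ := y
    exact ⟨(injective_iff_of_cycles (φ := φ)
      (x := ![a, φ a, φ (φ a), φ (φ (φ a)), b, φ b]) rfl rfl rfl ha rfl hb).2 ⟨ha', hb'⟩,
      rfl, rfl, rfl, ha, rfl, hb⟩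
  · rintro ⟨x, hi, h01, h12, h23, h30, h45, h54⟩
    refine Subtype.ext (funext fun i => ?_)
    fin_cases i <;> simp [hφ, h01, h12, h23, h45]

theorem stabilizer_frobTuples (x : frobTuples K) : MulAction.stabilizer (PGL2 K) x = ⊥ := by
  obtain ⟨x, hi, h01, h12, h23, h30, h45, h54⟩ := x
  have := (injective_iff_of_cycles h01 h12 h23 h30 h45 h54).1 hi
  rw [eq_bot_iff]
  intro g hg
  exact eq_one_of_smul_eq this.1 (congrFun (congrArg Subtype.val hg) 0)

end PGLClosure

/-- the number of `PGL₂(K)`-orbits of injective 6-tuples on `P¹(K̄)`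
satisfying the stated Frobenius conditions. -/
theorem statement11 (q : ℕ) (hq : IsPrimePow q)
    (K : Type*) [Field K] [Fintype K] (hK : Fintype.card K = q) :
    (Nat.card (Quotient (Setoid.comap
      (Subtype.val :
        {x : Fin 6 → Projectivization (AlgebraicClosure K) (Fin 2 → AlgebraicClosure K) //
          Function.Injective x ∧
          frobP1 q (x 0) = x 1 ∧
          frobP1 q (x 1) = x 2 ∧
          frobP1 q (x 2) = x 3 ∧
          frobP1 q (x 3) = x 0 ∧
          frobP1 q (x 4) = x 5 ∧
          frobP1 q (x 5) = x 4} →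
        (Fin 6 → Projectivization (AlgebraicClosure K) (Fin 2 → AlgebraicClosure K)))
      (MulAction.orbitRel (PGL2 K)
        (Fin 6 → Projectivization (AlgebraicClosure K) (Fin 2 → AlgebraicClosure K))))) : ℤ)
    = (q : ℤ) ^ 3 - (q : ℤ) ^ 2 := by
  subst hK
  have e := Nat.card_congr (MulAction.selfEquivOrbitsQuotientProd
    (stabilizer_frobTuples (K := K)))
  have hcomap := SubMulAction.orbitRel_of_subMul (frobTuples K)
  rw [Nat.card_prod, card_frobTuples, hcomap] at e
  have hP := card_PGL2 (K := K)
  change (Nat.card (Quotient ((MulAction.orbitRel (PGL2 K) _).comap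
    (Subtype.val : frobTuples K → _))) : ℤ) = _
  generalize Nat.card (Quotient ((MulAction.orbitRel (PGL2 K) _).comap
    (Subtype.val : frobTuples K → _))) = N at e ⊢
  have hq1 : 1 < Fintype.card K := Fintype.one_lt_card
  generalize Fintype.card K = q at *
  generalize Nat.card (PGL2 K) = G at *
  have l1 : q ≤ q ^ 2 := Nat.le_self_pow (by decide) q
  have l2 : q ^ 2 ≤ q ^ 4 := Nat.pow_le_pow_right (by omega) (by decide)
  have l3 : 1 ≤ q ^ 2 := by omega
  zify [l1, l2, l3, hq1.le] at e hP hq1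
  have p1 : (q : ℤ) ^ 2 - 1 ≠ 0 := by nlinarith
  have p2 : (q : ℤ) ^ 2 - q ≠ 0 := by nlinarith
  refine mul_right_cancel₀ (mul_ne_zero p1 p2) ?_
  linear_combination -(N : ℤ) * hP - ((q : ℤ) - 1) * e
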